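/- Let G[X,Y] be a finite bipartite graph and k ≥ 1 an integer with k·|Y| even; suppose G has no partial parity (g,f)-factor with respect to W = X, where f(v) = 2 for v ∈ X, f(v) = k for v ∈ Y, g(v) = 0 for v ∈ X, g(v) = k for v ∈ Y. If (A,B) is a biased barrier of G, then for every even component D of G − (A ∪ B) and every vertex v ∈ V(D), there is no edge of G from v to B. -/

import Mathlib

noncomputable section

/-- `eCnt G S T` is the number of edges of `G` with one endpoint in `S` and the other in `T`
(intended for disjoint `S` and `T`). -/
def eCnt {V : Type*} (G : SimpleGraph V) (S T : Set V) : ℕ :=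
  Nat.card {p : V × V // p.1 ∈ S ∧ p.2 ∈ T ∧ G.Adj p.1 p.2}

/-- The degree of `v` in `G − A` (the induced subgraph on the complement of `A`). -/
def degDel {V : Type*} (G : SimpleGraph V) (A : Set V) (v : V) : ℕ :=
  (G.neighborSet v \ A).ncard

/-- The vertex set of a connected component of an induced subgraph, viewed inside the
ambient vertex set. -/
def compSupp {V : Type*} {G : SimpleGraph V} {s : Set V}
    (c : (G.induce s).ConnectedComponent) : Set V :=
  Subtype.val '' c.supp

/-- A component `D` of `G − (A ∪ B)` is odd if `Σ_{v ∈ V(D)} f v + e_G(D,B)` is odd. -/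
def IsOddComp {V : Type*} (G : SimpleGraph V) (f : V → ℤ) (A B : Set V)
    (c : (G.induce (A ∪ B)ᶜ).ConnectedComponent) : Prop :=
  Odd ((∑ᶠ v ∈ compSupp c, f v) + (eCnt G (compSupp c) B : ℤ))

/-- A component `D` of `G − (A ∪ B)` is even if `Σ_{v ∈ V(D)} f v + e_G(D,B)` is even. -/
def IsEvenComp {V : Type*} (G : SimpleGraph V) (f : V → ℤ) (A B : Set V)
    (c : (G.induce (A ∪ B)ᶜ).ConnectedComponent) : Prop :=
  Even ((∑ᶠ v ∈ compSupp c, f v) + (eCnt G (compSupp c) B : ℤ))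

/-- `h_W(A,B)`: the number of components `D` of `G − (A ∪ B)` such that `g v = f v` for all
`v ∈ V(D) \ W` and `Σ_{v ∈ V(D)} f v + e_G(D,B) ≡ 1 (mod 2)`. -/
def hWnum {V : Type*} (G : SimpleGraph V) (W : Set V) (g f : V → ℤ) (A B : Set V) : ℕ :=
  Nat.card {c : (G.induce (A ∪ B)ᶜ).ConnectedComponent //
    (∀ v ∈ compSupp c \ W, g v = f v) ∧ IsOddComp G f A B c}

/-- `δ_G(A,B) = Σ_{v∈A} f v − Σ_{v∈B} g v + Σ_{v∈B} d_{G−A}(v) − h_W(A,B)`. -/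
def deltaG {V : Type*} (G : SimpleGraph V) (W : Set V) (g f : V → ℤ) (A B : Set V) : ℤ :=
  (∑ᶠ v ∈ A, f v) - (∑ᶠ v ∈ B, g v) + (∑ᶠ v ∈ B, (degDel G A v : ℤ)) -
    (hWnum G W g f A B : ℤ)

/-- `F` is a partial parity `(g,f)`-factor of `G` with respect to `W`: a spanning subgraph with
`g v ≤ d_F v ≤ f v` for all `v` and `d_F v ≡ g v ≡ f v (mod 2)` for `v ∈ W`. -/
def IsPPFactor {V : Type*} (G F : SimpleGraph V) (W : Set V) (g f : V → ℤ) : Prop :=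
  F ≤ G ∧
  (∀ v : V, g v ≤ ((F.neighborSet v).ncard : ℤ) ∧ ((F.neighborSet v).ncard : ℤ) ≤ f v) ∧
  (∀ v ∈ W, Int.ModEq 2 ((F.neighborSet v).ncard : ℤ) (g v) ∧
    Int.ModEq 2 ((F.neighborSet v).ncard : ℤ) (f v))

/-- `(A,B)` is a barrier: a pair of disjoint vertex sets with `δ_G(A,B) < 0`. -/
def IsBarrier {V : Type*} (G : SimpleGraph V) (W : Set V) (g f : V → ℤ) (A B : Set V) : Prop :=
  Disjoint A B ∧ deltaG G W g f A B < 0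

/-- `(A,B)` is a biased barrier: among all barriers, `δ_G(A,B)` is minimum; subject to that,
`|B|` is minimum; subject to that, `|A|` is maximum. -/
def IsBiasedBarrier {V : Type*} (G : SimpleGraph V) (W : Set V) (g f : V → ℤ)
    (A B : Set V) : Prop :=
  IsBarrier G W g f A B ∧
  (∀ A' B' : Set V, IsBarrier G W g f A' B' → deltaG G W g f A B ≤ deltaG G W g f A' B') ∧
  (∀ A' B' : Set V, IsBarrier G W g f A' B' →
    deltaG G W g f A' B' = deltaG G W g f A B → B.ncard ≤ B'.ncard) ∧
  (∀ A' B' : Set V, IsBarrier G W g f A' B' →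
    deltaG G W g f A' B' = deltaG G W g f A B → B'.ncard = B.ncard → A'.ncard ≤ A.ncard)

/-- The function `f` of the `(2,k)`-factor setting: `f = 2` on `X` and `f = k` on `Y`. -/
def fB (X Y : Type*) (k : ℕ) : X ⊕ Y → ℤ := Sum.elim (fun _ => 2) (fun _ => (k : ℤ))

/-- The function `g` of the `(2,k)`-factor setting: `g = 0` on `X` and `g = k` on `Y`. -/
def gB (X Y : Type*) (k : ℕ) : X ⊕ Y → ℤ := Sum.elim (fun _ => 0) (fun _ => (k : ℤ))

/-- `S` is the vertex set of a component of the subgraph induced on `s`: a minimal nonempty subset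
of `s` closed under adjacency in `s`. -/
structure IsCompSet {V : Type*} (G : SimpleGraph V) (s S : Set V) : Prop where
  nonempty : S.Nonempty
  subset : S ⊆ s
  closed : ∀ x ∈ S, ∀ y ∈ s, G.Adj x y → y ∈ S
  minimal : ∀ T ⊆ S, T.Nonempty → (∀ x ∈ T, ∀ y ∈ s, G.Adj x y → y ∈ T) → T = S

/-- The parity sum `Σ_{v ∈ S} f v + e_G(S,B)`. -/
def paritySum {V : Type*} (G : SimpleGraph V) (f : V → ℤ) (B S : Set V) : ℤ :=
  (∑ᶠ v ∈ S, f v) + (eCnt G S B : ℤ)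

/-- The vertex sets of the odd components of `G − (A ∪ B)`. -/
def oddCompSets {V : Type*} (G : SimpleGraph V) (f : V → ℤ) (A B : Set V) : Set (Set V) :=
  {S | IsCompSet G (A ∪ B)ᶜ S ∧ Odd (paritySum G f B S)}

section Components

variable {V : Type*} {G : SimpleGraph V} {s S T : Set V}

lemma isCompSet_compSupp (c : (G.induce s).ConnectedComponent) : IsCompSet G s (compSupp c) := by
  refine ⟨?_, ?_, ?_, ?_⟩
  · exact c.nonempty_supp.image _
  · rintro _ ⟨x, -, rfl⟩
    exact x.2
  · rintro _ ⟨x, hx, rfl⟩ y hy hxy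
    refine ⟨⟨y, hy⟩, ?_, rfl⟩
    rw [SimpleGraph.ConnectedComponent.mem_supp_iff] at hx ⊢
    rw [← hx]
    have h : (G.induce s).Adj x ⟨y, hy⟩ := hxy
    exact (SimpleGraph.ConnectedComponent.sound h.reachable).symm
  · rintro T hT ⟨t, ht⟩ hcl
    refine hT.antisymm ?_
    rintro _ ⟨y, hy, rfl⟩
    obtain ⟨t, htc, rfl⟩ := hT ht
    rw [SimpleGraph.ConnectedComponent.mem_supp_iff] at hy htc
    obtain ⟨p⟩ := SimpleGraph.ConnectedComponent.exact (htc.trans hy.symm)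
    clear hy htc
    induction p with
    | nil => exact ht
    | cons h _ ih => exact ih (hcl _ ht _ (Subtype.prop _) h)

lemma IsCompSet.eq_of_mem (hS : IsCompSet G s S) (hT : IsCompSet G s T) {x : V}
    (hxS : x ∈ S) (hxT : x ∈ T) : S = T := by
  have hcl : ∀ a ∈ S ∩ T, ∀ b ∈ s, G.Adj a b → b ∈ S ∩ T := fun a ha b hb hab =>
    ⟨hS.closed a ha.1 b hb hab, hT.closed a ha.2 b hb hab⟩
  exact (hS.minimal _ Set.inter_subset_left ⟨x, hxS, hxT⟩ hcl).symm.trans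
    (hT.minimal _ Set.inter_subset_right ⟨x, hxS, hxT⟩ hcl)

lemma compSupp_injective :
    Function.Injective (compSupp : (G.induce s).ConnectedComponent → Set V) := fun _ _ h =>
  SimpleGraph.ConnectedComponent.supp_injective (Subtype.val_injective.image_injective h)

lemma exists_compSupp_mem {x : V} (hx : x ∈ s) :
    ∃ c : (G.induce s).ConnectedComponent, x ∈ compSupp c :=
  ⟨(G.induce s).connectedComponentMk ⟨x, hx⟩, ⟨x, hx⟩, rfl, rfl⟩

lemma IsCompSet.exists_compSupp_eq (hS : IsCompSet G s S) :
    ∃ c : (G.induce s).ConnectedComponent, compSupp c = S := by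
  obtain ⟨x, hx⟩ := hS.nonempty
  obtain ⟨c, hc⟩ := exists_compSupp_mem (G := G) (hS.subset hx)
  exact ⟨c, (isCompSet_compSupp c).eq_of_mem hS hc hx⟩

lemma IsCompSet.diff_singleton {u : V} (hS : IsCompSet G s S) (hu : u ∉ S) :
    IsCompSet G (s \ {u}) S where
  nonempty := hS.nonempty
  subset _ hx := ⟨hS.subset hx, fun h => hu (h ▸ hx)⟩
  closed x hx y hy := hS.closed x hx y hy.1
  minimal T hT hne hcl := hS.minimal T hT hne fun x hx y hy hxy =>
    hcl x hx y ⟨hy, fun h => hu (h ▸ hS.closed x (hT hx) y hy hxy)⟩ hxy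

lemma IsCompSet.insert {u : V} (hS : IsCompSet G s S) (hu : ∀ x ∈ S, ¬ G.Adj x u) :
    IsCompSet G (insert u s) S where
  nonempty := hS.nonempty
  subset := hS.subset.trans (Set.subset_insert _ _)
  closed x hx y hy hxy := by
    rcases hy with rfl | hy
    · exact absurd hxy (hu x hx)
    · exact hS.closed x hx y hy hxy
  minimal T hT hne hcl := hS.minimal T hT hne fun x hx y hy => hcl x hx y (.inr hy)

lemma IsCompSet.sUnion_diff_singleton (hS : IsCompSet G s S) (u : V) :
    ⋃₀ {T | IsCompSet G (s \ {u}) T ∧ T ⊆ S} = S \ {u} := by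
  ext y
  constructor
  · rintro ⟨T, ⟨hT, hTS⟩, hy⟩
    exact ⟨hTS hy, (hT.subset hy).2⟩
  · rintro ⟨hyS, hyu⟩
    obtain ⟨c, hc⟩ := exists_compSupp_mem (G := G) (s := s \ {u}) ⟨hS.subset hyS, hyu⟩
    have hT := isCompSet_compSupp c
    refine ⟨compSupp c, ⟨hT, ?_⟩, hc⟩
    have h := hT.minimal (S ∩ compSupp c) Set.inter_subset_right ⟨y, hyS, hc⟩
      fun a ha b hb hab => ⟨hS.closed a ha.1 b hb.1 hab, hT.closed a ha.2 b hb hab⟩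
    exact h ▸ Set.inter_subset_left

lemma hWnum_eq_ncard {W : Set V} {g f : V → ℤ} (hgf : ∀ v ∉ W, g v = f v) (A B : Set V) :
    hWnum G W g f A B = (oddCompSets G f A B).ncard := by
  rw [← Nat.card_coe_set_eq]
  refine Nat.card_congr (Equiv.ofBijective
    (fun c => ⟨compSupp c.1, isCompSet_compSupp c.1, c.2.2⟩) ⟨?_, ?_⟩)
  · intro c d h
    exact Subtype.ext (compSupp_injective (congrArg Subtype.val h))
  · rintro ⟨S, hS, hodd⟩
    obtain ⟨c, rfl⟩ := hS.exists_compSupp_eq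
    exact ⟨⟨c, fun v hv => hgf v hv.2, hodd⟩, rfl⟩

lemma eCnt_comm (G : SimpleGraph V) (S T : Set V) : eCnt G S T = eCnt G T S :=
  Nat.card_congr ((Equiv.prodComm V V).subtypeEquiv fun p => by
    simp only [Equiv.prodComm_apply, Prod.fst_swap, Prod.snd_swap, G.adj_comm p.1 p.2]
    tauto)

lemma compl_insert_union (A B : Set V) (v : V) : (insert v A ∪ B)ᶜ = (A ∪ B)ᶜ \ {v} := by
  ext x
  simp only [Set.mem_compl_iff, Set.mem_union, Set.mem_insert_iff, Set.mem_sdiff,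
    Set.mem_singleton_iff]
  tauto

lemma eCnt_diff_singleton {B S : Set V} {b : V} (hb : ∀ x ∈ S, ¬ G.Adj x b) :
    eCnt G S (B \ {b}) = eCnt G S B := by
  refine Nat.card_congr (Equiv.subtypeEquivRight fun p => ?_)
  constructor
  · exact fun h => ⟨h.1, h.2.1.1, h.2.2⟩
  · exact fun h => ⟨h.1, ⟨h.2.1, fun hp => hb _ h.1 (hp ▸ h.2.2)⟩, h.2.2⟩

end Components

section Counting

variable {V : Type*} [Finite V] {G : SimpleGraph V} {f g : V → ℤ} {A B : Set V}

lemma finsum_mem_eq_add_diff_singleton {v : V} {S : Set V} (hv : v ∈ S) (φ : V → ℤ) :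
    ∑ᶠ x ∈ S, φ x = φ v + ∑ᶠ x ∈ S \ {v}, φ x := by
  rw [← finsum_mem_insert φ (by simp) (Set.toFinite _), Set.insert_sdiff_singleton,
    Set.insert_eq_of_mem hv]

lemma eCnt_eq_finsum (G : SimpleGraph V) (S T : Set V) :
    (eCnt G S T : ℤ) = ∑ᶠ v ∈ S, ((G.neighborSet v ∩ T).ncard : ℤ) := by
  classical
  have := Fintype.ofFinite S
  let e : {p : V × V // p.1 ∈ S ∧ p.2 ∈ T ∧ G.Adj p.1 p.2} ≃
      Σ v : S, ↥(G.neighborSet v.1 ∩ T) :=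
    { toFun p := ⟨⟨p.1.1, p.2.1⟩, ⟨p.1.2, p.2.2.2, p.2.2.1⟩⟩
      invFun q := ⟨(q.1.1, q.2.1), q.1.2, q.2.2.2, q.2.2.1⟩
      left_inv _ := rfl
      right_inv _ := rfl }
  rw [eCnt, Nat.card_congr e, Nat.card_sigma,
    ← finsum_set_coe_eq_finsum_mem S (f := fun v => ((G.neighborSet v ∩ T).ncard : ℤ)),
    finsum_eq_sum_of_fintype]
  simp [Nat.card_coe_set_eq]

lemma eCnt_singleton_left (G : SimpleGraph V) (v : V) (T : Set V) :
    eCnt G {v} T = (G.neighborSet v ∩ T).ncard := by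
  have := eCnt_eq_finsum G {v} T
  rw [finsum_mem_singleton] at this
  exact_mod_cast this

lemma paritySum_eq_finsum (G : SimpleGraph V) (f : V → ℤ) (B S : Set V) :
    paritySum G f B S = ∑ᶠ v ∈ S, (f v + (eCnt G {v} B : ℤ)) := by
  rw [finsum_mem_add_distrib S.toFinite, paritySum, eCnt_eq_finsum]
  simp_rw [eCnt_singleton_left]

lemma finsum_degDel_insert {v : V} (hv : v ∉ A) (B : Set V) :
    ∑ᶠ b ∈ B, (degDel G A b : ℤ) =
      ∑ᶠ b ∈ B, (degDel G (insert v A) b : ℤ) + (eCnt G {v} B : ℤ) := by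
  rw [eCnt_comm, eCnt_eq_finsum, ← finsum_mem_add_distrib B.toFinite]
  refine finsum_mem_congr rfl fun b _ => ?_
  rw [degDel, degDel, ← Nat.cast_add, ← Set.ncard_union_eq]
  · congr 2
    ext x
    by_cases hx : x = v
    · subst hx
      simp [hv]
    · simp [hx]
  · rw [Set.disjoint_left]
    rintro x ⟨-, hx⟩ ⟨-, rfl⟩
    exact hx (Set.mem_insert _ _)

lemma IsCompSet.exists_odd_subset_diff {s S : Set V} {u : V} (hS : IsCompSet G s S)
    (hodd : Odd (paritySum G f B (S \ {u}))) :
    ∃ T ⊆ S, IsCompSet G (s \ {u}) T ∧ Odd (paritySum G f B T) := by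
  by_contra! h
  rw [← Int.not_even_iff_odd] at hodd
  apply hodd
  rw [← hS.sUnion_diff_singleton u, paritySum_eq_finsum, finsum_mem_sUnion _ (Set.toFinite _)
    fun _ _ => Set.toFinite _]
  · refine finsum_mem_induction (p := Even) (by simp) (fun _ _ => Even.add) ?_
    rintro T ⟨hT, hTS⟩
    rw [← paritySum_eq_finsum]
    exact Int.not_odd_iff_even.1 (h T hTS hT)
  · rintro T ⟨hT, -⟩ U ⟨hU, -⟩ hne
    exact Set.disjoint_left.2 fun x hxT hxU => hne (hT.eq_of_mem hU hxT hxU)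

/-- Moving a vertex of an even component to `A` does not lose odd components, and gains one
if the parity of what is left of that component changes. -/
lemma ncard_oddCompSets_insert {D : Set V} {v : V} (hD : IsCompSet G (A ∪ B)ᶜ D)
    (heven : Even (paritySum G f B D)) (hv : v ∈ D) :
    (oddCompSets G f A B).ncard ≤ (oddCompSets G f (insert v A) B).ncard ∧
    (Odd (f v + (eCnt G {v} B : ℤ)) →
      (oddCompSets G f A B).ncard < (oddCompSets G f (insert v A) B).ncard) := by
  have hsub : oddCompSets G f A B ⊆ oddCompSets G f (insert v A) B := by
    rintro S ⟨hS, hodd⟩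
    refine ⟨?_, hodd⟩
    rw [compl_insert_union]
    refine hS.diff_singleton fun hvS => ?_
    rw [hS.eq_of_mem hD hvS hv] at hodd
    exact Int.not_odd_iff_even.2 heven hodd
  refine ⟨Set.ncard_le_ncard hsub (Set.toFinite _), fun hw => ?_⟩
  have hodd : Odd (paritySum G f B (D \ {v})) := by
    rw [paritySum_eq_finsum, finsum_mem_eq_add_diff_singleton hv, ← paritySum_eq_finsum] at heven
    by_contra h
    exact Int.not_odd_iff_even.2 heven (hw.add_even (Int.not_odd_iff_even.1 h))
  obtain ⟨T, hTD, hT, hTodd⟩ := hD.exists_odd_subset_diff hodd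
  refine Set.ncard_lt_ncard ((Set.ssubset_iff_of_subset hsub).2
    ⟨T, ⟨by rwa [compl_insert_union], hTodd⟩, fun h => ?_⟩) (Set.toFinite _)
  obtain ⟨x, hx⟩ := hT.nonempty
  rw [h.1.eq_of_mem hD hx (hTD hx)] at hTodd
  exact Int.not_odd_iff_even.2 heven hTodd

lemma ncard_adjacent_compSets_le (G : SimpleGraph V) (A B : Set V) (b : V) :
    {S | IsCompSet G (A ∪ B)ᶜ S ∧ ∃ x ∈ S, G.Adj x b}.ncard ≤ degDel G A b := by
  have : Nonempty V := ⟨b⟩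
  choose! φ hφ using fun S (h : S ∈ {S | IsCompSet G (A ∪ B)ᶜ S ∧ ∃ x ∈ S, G.Adj x b}) => h.2
  refine Set.ncard_le_ncard_of_injOn φ (fun S hS => ⟨(hφ S hS).2.symm, fun hA =>
    hS.1.subset (hφ S hS).1 (.inl hA)⟩) (fun S hS T hT h => ?_) (Set.toFinite _)
  exact hS.1.eq_of_mem hT.1 (hφ S hS).1 (h ▸ (hφ T hT).1)

/-- Deleting from `B` a vertex with a neighbour in an even component destroys fewer odd
components than the degree of that vertex. -/
lemma ncard_oddCompSets_lt_diff_singleton {D : Set V} {v b : V} (hAB : Disjoint A B)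
    (hD : IsCompSet G (A ∪ B)ᶜ D) (heven : Even (paritySum G f B D)) (hv : v ∈ D)
    (hb : b ∈ B) (hvb : G.Adj v b) :
    (oddCompSets G f A B).ncard < (oddCompSets G f A (B \ {b})).ncard + degDel G A b := by
  let N := {S | IsCompSet G (A ∪ B)ᶜ S ∧ ∃ x ∈ S, G.Adj x b}
  have hcompl : (A ∪ B \ {b})ᶜ = insert b (A ∪ B)ᶜ := by
    have hbA : b ∉ A := Set.disjoint_right.1 hAB hb
    ext x
    by_cases hx : x = b
    · subst hx
      simp [hbA]
    · simp [hx]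
  have hsub : oddCompSets G f A B ⊆ oddCompSets G f A (B \ {b}) ∪ N \ {D} := by
    rintro S ⟨hS, hodd⟩
    by_cases h : ∃ x ∈ S, G.Adj x b
    · refine .inr ⟨⟨hS, h⟩, ?_⟩
      rintro rfl
      exact Int.not_odd_iff_even.2 heven hodd
    · push Not at h
      refine .inl ⟨by rw [hcompl]; exact hS.insert h, ?_⟩
      rwa [paritySum, eCnt_diff_singleton h]
  have h1 := (Set.ncard_le_ncard hsub (Set.toFinite _)).trans (Set.ncard_union_le _ _)
  have h2 := Set.ncard_sdiff_singleton_lt_of_mem (s := N) (a := D) ⟨hD, v, hv, hvb⟩ (Set.toFinite _)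
  have h3 : N.ncard ≤ degDel G A b := ncard_adjacent_compSets_le G A B b
  omega

lemma deltaG_insert_le {W D : Set V} {v : V} (hgf : ∀ v ∉ W, g v = f v)
    (hD : IsCompSet G (A ∪ B)ᶜ D) (heven : Even (paritySum G f B D)) (hv : v ∈ D)
    (hf : f v = 2) (he : eCnt G {v} B ≠ 0) :
    deltaG G W g f (insert v A) B ≤ deltaG G W g f A B := by
  have hvA : v ∉ A := fun h => hD.subset hv (.inl h)
  obtain ⟨hle, hlt⟩ := ncard_oddCompSets_insert hD heven hv
  rw [deltaG, deltaG, hWnum_eq_ncard hgf, hWnum_eq_ncard hgf, finsum_degDel_insert hvA,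
    finsum_mem_insert _ hvA A.toFinite, hf]
  rcases Nat.even_or_odd (eCnt G {v} B) with ⟨m, hm⟩ | hodd
  · omega
  · have := hlt (by rw [hf]; exact even_two.add_odd (by exact_mod_cast hodd))
    omega

lemma deltaG_diff_singleton_lt {W D : Set V} {v b : V} (hgf : ∀ v ∉ W, g v = f v)
    (hAB : Disjoint A B) (hD : IsCompSet G (A ∪ B)ᶜ D) (heven : Even (paritySum G f B D))
    (hv : v ∈ D) (hb : b ∈ B) (hvb : G.Adj v b) (hg : g b = 0) :
    deltaG G W g f A (B \ {b}) < deltaG G W g f A B := by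
  have hlt := ncard_oddCompSets_lt_diff_singleton hAB hD heven hv hb hvb
  rw [deltaG, deltaG, hWnum_eq_ncard hgf, hWnum_eq_ncard hgf,
    finsum_mem_eq_add_diff_singleton hb g,
    finsum_mem_eq_add_diff_singleton hb fun x => (degDel G A x : ℤ), hg]
  omega

end Counting

/-- for a biased barrier `(A,B)`, no vertex of an even component of
`G − (A ∪ B)` sends an edge to `B`. -/
theorem biased_barrier_even_comp_eB_eq_zero {X Y : Type*} [Fintype X] [Fintype Y]
    (G : SimpleGraph (X ⊕ Y))
    (hX : ∀ x x' : X, ¬ G.Adj (Sum.inl x) (Sum.inl x'))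
    (hY : ∀ y y' : Y, ¬ G.Adj (Sum.inr y) (Sum.inr y'))
    (k : ℕ) (hk : 1 ≤ k) (heven : Even (k * Fintype.card Y))
    (hno : ¬ ∃ F : SimpleGraph (X ⊕ Y),
      IsPPFactor G F (Set.range (Sum.inl : X → X ⊕ Y)) (gB X Y k) (fB X Y k))
    (A B : Set (X ⊕ Y))
    (hAB : IsBiasedBarrier G (Set.range (Sum.inl : X → X ⊕ Y)) (gB X Y k) (fB X Y k) A B)
    (c : (G.induce (A ∪ B)ᶜ).ConnectedComponent)
    (heven' : IsEvenComp G (fB X Y k) A B c)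
    (v : X ⊕ Y) (hv : v ∈ compSupp c) :
    eCnt G {v} B = 0 := by
  have hgf : ∀ u ∉ Set.range (Sum.inl : X → X ⊕ Y), gB X Y k u = fB X Y k u := by
    rintro (x | y) h
    · exact absurd ⟨x, rfl⟩ h
    · rfl
  obtain ⟨⟨hdisj, hneg⟩, hmin, -, hmax⟩ := hAB
  have hD := isCompSet_compSupp c
  have hvAB : v ∉ A ∪ B := hD.subset hv
  by_contra he
  rcases v with x | y
  · have hle := deltaG_insert_le hgf hD heven' hv rfl he
    have hbar : IsBarrier G (Set.range (Sum.inl : X → X ⊕ Y)) (gB X Y k) (fB X Y k)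
        (insert (Sum.inl x) A) B :=
      ⟨Set.disjoint_insert_left.2 ⟨fun h => hvAB (.inr h), hdisj⟩, hle.trans_lt hneg⟩
    have hcard := hmax _ _ hbar (hle.antisymm (hmin _ _ hbar)) rfl
    rw [Set.ncard_insert_of_notMem (fun h => hvAB (.inl h)) A.toFinite] at hcard
    omega
  · rw [eCnt_singleton_left] at he
    obtain ⟨b, hyb, hb⟩ := Set.nonempty_of_ncard_ne_zero he
    rcases b with x | y'
    · have hlt := deltaG_diff_singleton_lt hgf hdisj hD heven' hv hb hyb rfl
      exact (hmin _ _ ⟨hdisj.mono_right Set.sdiff_subset, hlt.trans hneg⟩).not_gt hlt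
    · exact hY y y' hyb
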